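/- arXiv:2404.00655 — 5 statements merged into one kernel-verified Lean document; each statement's English description precedes it below -/
import Mathlib

section
/- The matrix M̄ := W_r W_rᵀ is the Moore–Penrose pseudoinverse of M; that is, M M̄ M = M, M̄ M M̄ = M̄, (M M̄)ᵀ = M M̄, and (M̄ M)ᵀ = M̄ M. -/
open Matrix

theorem Matrix.exists_eq_mul_of_range_mulVecLin_le {R l m n : Type*} [CommSemiring R]
    [Fintype m] [Fintype n] [DecidableEq n] {A : Matrix l m R} {B : Matrix l n R}
    (h : LinearMap.range B.mulVecLin ≤ LinearMap.range A.mulVecLin) :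
    ∃ Y : Matrix m n R, B = A * Y := by
  have hcol (j : n) : ∃ v : m → R, A *ᵥ v = B *ᵥ Pi.single j 1 := by
    obtain ⟨v, hv⟩ := h (LinearMap.mem_range_self B.mulVecLin (Pi.single j 1))
    exact ⟨v, hv⟩
  choose Y hY using hcol
  refine ⟨(Matrix.of Y)ᵀ, ?_⟩
  ext i j
  have hij := congrFun (hY j) i
  rw [Matrix.mulVec_single_one] at hij
  exact hij.symm

/-- For symmetric positive semidefinite `M` of rank `r` and `W_r` with
`range(W_r) = range(M)` and `W_rᵀ M W_r = I_r`, the matrix `M̄ := W_r W_rᵀ` is the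
Moore–Penrose pseudoinverse of `M`. -/
theorem stmt_4 (n r : ℕ) (M : Matrix (Fin n) (Fin n) ℝ)
    (W : Matrix (Fin n) (Fin r) ℝ)
    (hM : M.PosSemidef) (hMr : M.rank = r)
    (hW : LinearMap.range W.mulVecLin = LinearMap.range M.mulVecLin)
    (hWMW : Wᵀ * M * W = 1) :
    M * (W * Wᵀ) * M = M ∧
    (W * Wᵀ) * M * (W * Wᵀ) = W * Wᵀ ∧
    (M * (W * Wᵀ))ᵀ = M * (W * Wᵀ) ∧
    ((W * Wᵀ) * M)ᵀ = (W * Wᵀ) * M := by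
  obtain ⟨Y, hY⟩ := Matrix.exists_eq_mul_of_range_mulVecLin_le hW.ge
  have hMt : Mᵀ = M := by simpa using hM.isHermitian.eq
  have hBW : W * Wᵀ * M * W = W := by
    rw [Matrix.mul_assoc W, Matrix.mul_assoc W, hWMW, Matrix.mul_one]
  have hBt : (W * Wᵀ)ᵀ = W * Wᵀ := by simp
  have hBMB : W * Wᵀ * M * (W * Wᵀ) = W * Wᵀ := by
    rw [← Matrix.mul_assoc, hBW]
  have hBMM : W * Wᵀ * M * M = M := by
    have h : W * Wᵀ * M * (W * Y) = W * Y := by rw [← Matrix.mul_assoc, hBW]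
    rwa [← hY] at h
  generalize W * Wᵀ = B at hBt hBMB hBMM ⊢
  have hMMB : M * (M * B) = M := by
    simpa [Matrix.transpose_mul, hMt, hBt] using congrArg Matrix.transpose hBMM
  have hcomm : M * B = B * M := by
    calc M * B = B * M * M * B := by rw [hBMM]
      _ = B * (M * (M * B)) := by simp only [Matrix.mul_assoc]
      _ = B * M := by rw [hMMB]
  refine ⟨by rw [hcomm, hBMM], hBMB, ?_, ?_⟩
  · rw [Matrix.transpose_mul, hMt, hBt, hcomm]
  · rw [Matrix.transpose_mul, hMt, hBt, hcomm]
end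

section
/- There exist a matrix F ∈ ℝ^{n×r} whose columns all lie in range(M) and which satisfies Fᵀ M F = I_r, an orthogonal matrix H ∈ ℝ^{m×m}, and a matrix Σ ∈ ℝ^{m×r} with Σ_{ij} = 0 for i ≠ j and Σ_{ii} ≥ 0, such that A F = H Σ and, for every v ∈ range(M), A v = H Σ Fᵀ M v (singular value expansion of the operator v ↦ Av from (range(M), ⟨·,·⟩_M) to ℝ^m). -/
open Matrix

open Module in
/-- **Singular value decomposition**: a linear map between finite-dimensional real inner product
spaces is diagonal, with its singular values on the diagonal, in suitable orthonormal bases. -/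
theorem LinearMap.exists_orthonormalBasis_apply_eq_singularValues_smul
    {E F : Type*} [NormedAddCommGroup E] [InnerProductSpace ℝ E] [FiniteDimensional ℝ E]
    [NormedAddCommGroup F] [InnerProductSpace ℝ F] [FiniteDimensional ℝ F]
    (T : E →ₗ[ℝ] F) {r m : ℕ} (hE : finrank ℝ E = r) (hF : finrank ℝ F = m) :
    ∃ (b : OrthonormalBasis (Fin r) ℝ E) (c : OrthonormalBasis (Fin m) ℝ F),
      (∀ (i : Fin m) (j : Fin r), (i : ℕ) = j → T (b j) = T.singularValues j • c i) ∧
      ∀ j : Fin r, m ≤ j → T (b j) = 0 := by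
  let b := T.isSymmetric_adjoint_comp_self.eigenvectorBasis hE
  have inner_apply (i j : Fin r) :
      inner ℝ (T (b i)) (T (b j)) = if i = j then T.singularValues j ^ 2 else 0 := by
    have h := T.isSymmetric_adjoint_comp_self.apply_eigenvectorBasis hE j
    rw [← LinearMap.adjoint_inner_right, ← LinearMap.comp_apply, h, inner_smul_right,
      orthonormal_iff_ite.mp b.orthonormal, T.sq_singularValues_fin hE j]
    simp
  have apply_eq_zero (j : Fin r) (hj : T.singularValues j = 0) : T (b j) = 0 := by
    rw [← inner_self_eq_zero (𝕜 := ℝ), inner_apply, if_pos rfl, hj, sq, mul_zero]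
  let v (i : Fin m) : F :=
    if h : (i : ℕ) < r then (T.singularValues i)⁻¹ • T (b ⟨i, h⟩) else 0
  let s : Set (Fin m) := {i | (i : ℕ) < r ∧ T.singularValues i ≠ 0}
  have hv : Orthonormal ℝ (s.domRestrict v) := by
    rw [orthonormal_iff_ite]
    rintro ⟨i, hir, hi⟩ ⟨j, hjr, hj⟩
    simp only [Set.domRestrict_apply, v, hir, hjr, dif_pos, inner_smul_left, inner_smul_right,
      inner_apply, Fin.mk.injEq, Subtype.mk.injEq, Fin.val_inj]
    split_ifs with h
    · subst h
      simp only [conj_trivial]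
      field_simp
    · simp
  obtain ⟨c, hc⟩ := hv.exists_orthonormalBasis_extension_of_card_eq (by simpa using hF)
  refine ⟨b, c, fun i j hij => ?_, fun j hj => apply_eq_zero j ?_⟩
  · by_cases h : T.singularValues j = 0
    · rw [h, zero_smul, apply_eq_zero j h]
    · have hir : (i : ℕ) < r := hij ▸ j.isLt
      rw [hc i ⟨hir, hij ▸ h⟩]
      simp only [v, dif_pos hir, hij]
      rw [smul_inv_smul₀ h]
  · rw [T.singularValues_eq_zero_iff_le_finrank_range]
    exact (Submodule.finrank_le _).trans (hF.trans_le hj)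

theorem OrthonormalBasis.transpose_mul_self_of_apply {n : ℕ}
    (b : OrthonormalBasis (Fin n) ℝ (EuclideanSpace ℝ (Fin n))) :
    (Matrix.of fun i j => b j i)ᵀ * (Matrix.of fun i j => b j i) = 1 := by
  ext i j
  have h := orthonormal_iff_ite.mp b.orthonormal i j
  rw [PiLp.inner_apply] at h
  simpa [Matrix.mul_apply, Matrix.one_apply, mul_comm] using h

/-- **Singular value decomposition** of a real matrix. -/
theorem Matrix.exists_mul_eq_mul_diagonal {m r : ℕ} (A : Matrix (Fin m) (Fin r) ℝ) :
    ∃ (W : Matrix (Fin r) (Fin r) ℝ) (H : Matrix (Fin m) (Fin m) ℝ)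
      (S : Matrix (Fin m) (Fin r) ℝ),
      Wᵀ * W = 1 ∧ Hᵀ * H = 1 ∧
      (∀ (i : Fin m) (j : Fin r), (i : ℕ) ≠ j → S i j = 0) ∧
      (∀ (i : Fin m) (j : Fin r), (i : ℕ) = j → 0 ≤ S i j) ∧
      A * W = H * S := by
  let T := A.toEuclideanLin
  obtain ⟨b, c, hT, hT₀⟩ := T.exists_orthonormalBasis_apply_eq_singularValues_smul
    (r := r) (m := m) (by simp) (by simp)
  refine ⟨of fun i j => b j i, of fun i j => c j i,
    of fun i j => if (i : ℕ) = j then T.singularValues j else 0,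
    b.transpose_mul_self_of_apply, c.transpose_mul_self_of_apply,
    fun i j hij => by simp [hij], fun i j hij => by simp [hij, T.singularValues_nonneg], ?_⟩
  ext i j
  have hl : (A * of fun i j => b j i) i j = T (b j) i := by
    simp [T, Matrix.mul_apply, Matrix.mulVec, dotProduct]
  rw [hl, Matrix.mul_apply]
  simp only [of_apply]
  by_cases hj : (j : ℕ) < m
  · rw [hT ⟨j, hj⟩ j rfl, Finset.sum_eq_single ⟨j, hj⟩]
    · simp [mul_comm]
    · intro k _ hk
      rw [if_neg fun h => hk (Fin.ext h), mul_zero]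
    · simp
  · rw [hT₀ j (not_lt.mp hj), Finset.sum_eq_zero]
    · simp
    · intro k _
      rw [if_neg (by omega), mul_zero]

/-- The range of a positive semidefinite matrix `M` has a basis that is orthonormal for the
bilinear form of `M`. -/
theorem Matrix.PosSemidef.exists_range_transpose_mul_mul_eq_one {n r : ℕ}
    {M : Matrix (Fin n) (Fin n) ℝ} (hM : M.PosSemidef) (hr : M.rank = r) :
    ∃ G : Matrix (Fin n) (Fin r) ℝ,
      (∀ j, (fun i => G i j) ∈ LinearMap.range M.mulVecLin) ∧ Gᵀ * M * G = 1 := by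
  have hH := hM.isHermitian
  let e : Fin r ≃ {i // hH.eigenvalues i ≠ 0} :=
    (Fintype.equivFinOfCardEq (hH.rank_eq_card_non_zero_eigs.symm.trans hr)).symm
  let l (k : Fin r) : ℝ := hH.eigenvalues (e k)
  let u (k : Fin r) := hH.eigenvectorBasis (e k)
  have hl (k : Fin r) : 0 < l k := (hM.eigenvalues_nonneg _).lt_of_ne' (e k).2
  have hu (k : Fin r) : M *ᵥ u k = l k • ⇑(u k) := hH.mulVec_eigenvectorBasis _
  have horth (j k : Fin r) : u j ⬝ᵥ u k = if j = k then 1 else 0 := by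
    have h := orthonormal_iff_ite.mp hH.eigenvectorBasis.orthonormal (e j) (e k)
    simpa [PiLp.inner_apply, dotProduct, mul_comm, Subtype.val_inj, u] using h
  let g (k : Fin r) : Fin n → ℝ := (√(l k))⁻¹ • ⇑(u k)
  have hg (k : Fin r) : M *ᵥ g k = l k • g k := by
    rw [mulVec_smul, hu, smul_comm]
  refine ⟨of fun i j => g j i, fun j => ⟨(l j)⁻¹ • g j, ?_⟩, ?_⟩
  · rw [mulVecLin_apply, mulVec_smul, hg, inv_smul_smul₀ (hl j).ne']
    rfl
  · ext j k
    have h : ((of fun i j => g j i)ᵀ * M * (of fun i j => g j i)) j k = g j ⬝ᵥ (M *ᵥ g k) := by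
      rw [Matrix.mul_assoc]
      rfl
    rw [h, hg, Matrix.one_apply]
    simp only [g, dotProduct_smul, smul_dotProduct, horth, smul_eq_mul]
    split_ifs with hjk
    · subst hjk
      have := (hl j).ne'
      have := (Real.sqrt_pos.mpr (hl j)).ne'
      field_simp
      exact (Real.sq_sqrt (hl j).le).symm
    · simp

/-- If the columns of `F` lie in the range of `M`, are orthonormal for `M`, and are as many as the
rank of `M`, then `F * Fᵀ * M` is a projection onto the range of `M`. -/
theorem Matrix.mulVec_transpose_mul_mulVec_of_mem_range {n r : ℕ}
    {M : Matrix (Fin n) (Fin n) ℝ} {F : Matrix (Fin n) (Fin r) ℝ} (hr : M.rank = r)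
    (hF : LinearMap.range F.mulVecLin ≤ LinearMap.range M.mulVecLin) (h1 : Fᵀ * M * F = 1)
    {v : Fin n → ℝ} (hv : v ∈ LinearMap.range M.mulVecLin) :
    (F * Fᵀ * M) *ᵥ v = v := by
  have hinj : Function.Injective F.mulVecLin := fun x y hxy => by
    simpa [mulVec_mulVec, h1] using congr((Fᵀ * M) *ᵥ $hxy)
  have heq := Submodule.eq_of_le_of_finrank_eq hF <| by
    rw [LinearMap.finrank_range_of_inj hinj, Module.finrank_fin_fun]
    exact hr.symm
  obtain ⟨c, rfl⟩ := heq.ge hv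
  rw [mulVecLin_apply, mulVec_mulVec, Matrix.mul_assoc F, Matrix.mul_assoc F, h1, Matrix.mul_one]

/-- Singular value expansion of the operator `v ↦ Av` from
`(range(M), ⟨·,·⟩_M)` to `ℝ^m`: there exist `F ∈ ℝ^{n×r}` with columns in `range(M)` and
`Fᵀ M F = I_r`, an orthogonal `H ∈ ℝ^{m×m}`, and `Σ ∈ ℝ^{m×r}` with zero off-diagonal and
nonnegative diagonal entries, such that `A F = H Σ` and `A v = H Σ Fᵀ M v` for every
`v ∈ range(M)`. -/
theorem stmt_5 (m n r : ℕ) (A : Matrix (Fin m) (Fin n) ℝ)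
    (M : Matrix (Fin n) (Fin n) ℝ) (hM : M.PosSemidef) (hMr : M.rank = r) :
    ∃ (F : Matrix (Fin n) (Fin r) ℝ) (H : Matrix (Fin m) (Fin m) ℝ)
      (S : Matrix (Fin m) (Fin r) ℝ),
      (∀ j : Fin r, (fun i => F i j) ∈ LinearMap.range M.mulVecLin) ∧
      Fᵀ * M * F = 1 ∧
      Hᵀ * H = 1 ∧
      (∀ (i : Fin m) (j : Fin r), (i : ℕ) ≠ (j : ℕ) → S i j = 0) ∧
      (∀ (i : Fin m) (j : Fin r), (i : ℕ) = (j : ℕ) → 0 ≤ S i j) ∧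
      A * F = H * S ∧
      (∀ v ∈ LinearMap.range M.mulVecLin, A.mulVec v = (H * S * Fᵀ * M).mulVec v) := by
  obtain ⟨G, hG, hG1⟩ := hM.exists_range_transpose_mul_mul_eq_one hMr
  obtain ⟨W, H, S, hW, hH, hS₀, hS, hAW⟩ := (A * G).exists_mul_eq_mul_diagonal
  have hrange : LinearMap.range (G * W).mulVecLin ≤ LinearMap.range M.mulVecLin := by
    rw [mulVecLin_mul]
    refine (LinearMap.range_comp_le_range _ _).trans ?_
    rw [range_mulVecLin, Submodule.span_le]
    rintro _ ⟨j, rfl⟩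
    exact hG j
  have hGW : (G * W)ᵀ * M * (G * W) = 1 := by
    calc (G * W)ᵀ * M * (G * W) = Wᵀ * (Gᵀ * M * G) * W := by
          simp only [transpose_mul, Matrix.mul_assoc]
      _ = 1 := by rw [hG1, Matrix.mul_one, hW]
  have hAGW : A * (G * W) = H * S := by rw [← Matrix.mul_assoc, hAW]
  refine ⟨G * W, H, S, fun j => hrange ?_, hGW, hH, hS₀, hS, hAGW, fun v hv => ?_⟩
  · rw [range_mulVecLin]
    exact Submodule.subset_span ⟨j, rfl⟩
  · rw [← hAGW, Matrix.mul_assoc A, Matrix.mul_assoc A, ← mulVec_mulVec,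
      mulVec_transpose_mul_mulVec_of_mem_range hMr hrange hGW hv]
end

section
/- Suppose α_i > 0 and β_i > 0 for 1 ≤ i ≤ k (the gGKB process does not terminate before step k). Then each v_i (1 ≤ i ≤ k) lies in range(M); the vectors v₁, …, v_k are M-orthonormal (v_iᵀ M v_j = δ_{ij}) and span the Krylov subspace 𝒦_k(M^†AᵀGA, M^†AᵀGb) := span{(M^†AᵀGA)^j M^†AᵀGb : 0 ≤ j ≤ k−1}; and the vectors u₁, …, u_k are G-orthonormal (u_iᵀ G u_j = δ_{ij}) and span the Krylov subspace 𝒦_k(AM^†AᵀG, b) := span{(AM^†AᵀG)^j b : 0 ≤ j ≤ k−1}. -/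
open Matrix

open Submodule in
/-- A sequence `w` with `T (w j) ∈ c (j + 1) • w (j + 1) + span {w 0, …, w j}` and nonzero `c j`
spans the Krylov subspaces generated by `T` and `c 0 • w 0`. -/
theorem span_image_Iio_eq_of_recurrence {K V : Type*} [Field K] [AddCommGroup V] [Module K V]
    (T : V →ₗ[K] V) (w y : ℕ → V) (c : ℕ → K) (k : ℕ)
    (hy0 : y 0 = c 0 • w 0) (hy : ∀ j, y (j + 1) = T (y j)) (hc : ∀ j < k, c j ≠ 0)
    (hw : ∀ j, j + 1 < k →
      T (w j) - c (j + 1) • w (j + 1) ∈ span K (w '' Set.Iio (j + 1))) :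
    span K (w '' Set.Iio k) = span K (y '' Set.Iio k) := by
  induction k with
  | zero => simp
  | succ l ih =>
    have ih := ih (fun j hj => hc j (by omega)) (fun j hj => hw j (by omega))
    have hmono : ∀ (z : ℕ → V) {p q : ℕ}, p ≤ q →
        span K (z '' Set.Iio p) ≤ span K (z '' Set.Iio q) := fun z p q h =>
      span_mono (Set.image_mono (Set.Iio_subset_Iio h))
    have hmem : ∀ (z : ℕ → V) {p q : ℕ}, p < q → z p ∈ span K (z '' Set.Iio q) :=
      fun z p q h => subset_span ⟨p, h, rfl⟩
    have hTw : span K (w '' Set.Iio l) ≤ (span K (w '' Set.Iio (l + 1))).comap T := by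
      rw [span_le]
      rintro _ ⟨j, hj, rfl⟩
      have hj' : j < l := hj
      have h := add_mem (hmono w (by omega) (hw j (by omega)))
        (smul_mem _ (c (j + 1)) (hmem w (show j + 1 < l + 1 by omega)))
      simpa using h
    have hTy : span K (y '' Set.Iio l) ≤ (span K (y '' Set.Iio (l + 1))).comap T := by
      rw [span_le]
      rintro _ ⟨j, hj, rfl⟩
      have hj' : j < l := hj
      simpa [hy] using hmem y (show j + 1 < l + 1 by omega)
    have hwy : w l ∈ span K (y '' Set.Iio (l + 1)) := by
      rw [← smul_mem_iff _ (hc l (by omega))]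
      cases l with
      | zero => simp [← hy0]
      | succ p =>
        have h1 := hmono y (Nat.le_succ _) (ih ▸ hw p (by omega))
        have h2 : T (w p) ∈ span K (y '' Set.Iio (p + 1 + 1)) :=
          hTy (show w p ∈ span K (y '' Set.Iio (p + 1)) from ih ▸ hmem w (Nat.lt_succ_self p))
        simpa using sub_mem h2 h1
    have hyw : y l ∈ span K (w '' Set.Iio (l + 1)) := by
      cases l with
      | zero => simpa [hy0] using smul_mem _ (c 0) (hmem w (show 0 < 1 by omega))
      | succ p =>
        rw [hy]
        exact hTw (ih ▸ hmem y (Nat.lt_succ_self p))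
    apply le_antisymm <;> rw [span_le] <;> rintro _ ⟨j, hj, rfl⟩
    · rcases (Nat.lt_succ_iff_lt_or_eq.mp hj) with h | rfl
      · exact hmono y (Nat.le_succ l) (ih ▸ hmem w h)
      · exact hwy
    · rcases (Nat.lt_succ_iff_lt_or_eq.mp hj) with h | rfl
      · exact hmono w (Nat.le_succ l) (ih ▸ hmem y h)
      · exact hyw

/-- Vectors generated by the Golub-Kahan bidiagonalization of a pair of maps `A`, `P`, adjoint to
each other along the `v i`, are orthonormal with respect to the underlying bilinear forms. -/
theorem golubKahan_orthonormal {U V : Type*} [AddCommGroup U] [Module ℝ U]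
    [AddCommGroup V] [Module ℝ V] (BU : LinearMap.BilinForm ℝ U) (BV : LinearMap.BilinForm ℝ V)
    (hBU : ∀ x y, BU x y = BU y x) (hBV : ∀ x y, BV x y = BV y x)
    (A : V →ₗ[ℝ] U) (P : U →ₗ[ℝ] V) (u : ℕ → U) (v : ℕ → V) (α β : ℕ → ℝ) (k : ℕ)
    (hv0 : v 0 = 0) (hAv : ∀ i, 1 ≤ i → A (v i) = β (i + 1) • u (i + 1) + α i • u i)
    (hPu : ∀ i, 1 ≤ i → P (u i) = α i • v i + β i • v (i - 1))
    (hadj : ∀ i x, 1 ≤ i → i ≤ k → BV (v i) (P x) = BU (A (v i)) x)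
    (hα : ∀ i, 1 ≤ i → i ≤ k → α i ≠ 0) (hβ : ∀ i, 1 ≤ i → i ≤ k → β i ≠ 0)
    (hv : ∀ i, 1 ≤ i → i ≤ k → BV (v i) (v i) = 1)
    (hu : ∀ i, 1 ≤ i → i ≤ k → BU (u i) (u i) = 1) :
    (∀ i j, 1 ≤ i → i ≤ k → 1 ≤ j → j ≤ k → BV (v i) (v j) = if i = j then 1 else 0) ∧
    (∀ i j, 1 ≤ i → i ≤ k → 1 ≤ j → j ≤ k → BU (u i) (u j) = if i = j then 1 else 0) := by
  have key : ∀ l, l ≤ k → ∀ j, j ≤ l → ∀ i, 1 ≤ i → i < j →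
      BV (v i) (v j) = 0 ∧ BU (u i) (u j) = 0 := by
    intro l
    induction l with
    | zero => intros; omega
    | succ l ih =>
      intro hl j hj i hi hij
      have ih := ih (by omega)
      rcases Nat.lt_or_ge j (l + 1) with hjl | hjl
      · exact ih j (by omega) i hi hij
      obtain rfl : j = l + 1 := by omega
      have hU : ∀ i, 1 ≤ i → i < l + 1 → BU (u i) (u (l + 1)) = 0 := by
        intro i hi hil
        have hprev : BV (v l) (v (i - 1)) = 0 := by
          rcases Nat.eq_zero_or_pos (i - 1) with h | h
          · rw [h, hv0, map_zero]
          · rw [hBV, (ih l le_rfl (i - 1) h (by omega)).1]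
        have h := hadj l (u i) (by omega) (by omega)
        rw [hAv l (by omega), hPu i hi] at h
        simp only [map_add, map_smul, LinearMap.add_apply, LinearMap.smul_apply, smul_eq_mul,
          hprev] at h
        rw [hBU, ← mul_right_inj' (hβ (l + 1) (by omega) hl)]
        rcases Nat.lt_succ_iff_lt_or_eq.mp hil with hlt | rfl
        · rw [hBV, (ih l le_rfl i hi hlt).1, hBU (u l), (ih l le_rfl i hi hlt).2] at h
          linarith
        · rw [hv i hi (by omega), hu i hi (by omega)] at h
          linarith
      refine ⟨?_, hU i hi hij⟩
      have h := hadj i (u (l + 1)) hi (by omega)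
      rw [hAv i hi, hPu (l + 1) (by omega)] at h
      simp only [map_add, map_smul, LinearMap.add_apply, LinearMap.smul_apply, smul_eq_mul,
        hU i hi hij, Nat.add_sub_cancel] at h
      rw [← mul_right_inj' (hα (l + 1) (by omega) hl)]
      rcases Nat.lt_succ_iff_lt_or_eq.mp hij with hlt | rfl
      · rw [(ih l le_rfl i hi hlt).1, hU (i + 1) (by omega) (by omega)] at h
        linarith
      · rw [hv i hi (by omega), hu (i + 1) (by omega) hl] at h
        linarith
  constructor <;> intro i j hi hik hj hjk <;> rcases lt_trichotomy i j with h | rfl | h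
  · rw [if_neg h.ne, (key k le_rfl j hjk i hi h).1]
  · rw [if_pos rfl, hv i hi hik]
  · rw [if_neg h.ne', hBV, (key k le_rfl i hik j hj h).1]
  · rw [if_neg h.ne, (key k le_rfl j hjk i hi h).2]
  · rw [if_pos rfl, hu i hi hik]
  · rw [if_neg h.ne', hBU, (key k le_rfl i hik j hj h).2]

theorem range_fin_eq_image_Iio {V : Type*} (w : ℕ → V) (k : ℕ) :
    (Set.range fun i : Fin k => w i) = w '' Set.Iio k := by
  ext x
  simp [Fin.exists_iff]

theorem toBilin'_apply_comm {ι : Type*} [Fintype ι] [DecidableEq ι] {N : Matrix ι ι ℝ}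
    (hN : N.IsHermitian) (x y : ι → ℝ) : N.toBilin' x y = N.toBilin' y x := by
  have h : Nᵀ = N := by simpa [conjTranspose_eq_transpose_of_trivial] using hN.eq
  rw [toBilin'_apply', toBilin'_apply', dotProduct_comm, dotProduct_mulVec, ← mulVec_transpose, h,
    dotProduct_comm]

/-- The range of the pseudoinverse of a symmetric matrix is contained in the range of the matrix. -/
theorem pseudoinverse_mulVec_mem_range {ι : Type*} [Fintype ι] {M N : Matrix ι ι ℝ}
    (hM : Mᵀ = M) (hNMN : N * M * N = N) (hNM : (N * M)ᵀ = N * M) (x : ι → ℝ) :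
    N *ᵥ x ∈ LinearMap.range M.mulVecLin := by
  refine ⟨(Nᵀ * N) *ᵥ x, ?_⟩
  rw [mulVecLin_apply, mulVec_mulVec, ← Matrix.mul_assoc]
  nth_rw 1 [← hM]
  rw [← transpose_mul, hNM, hNMN]

/-- Properties of the gGKB process. If `α_i, β_i > 0` for `1 ≤ i ≤ k`, then
each `v_i` lies in `range(M)`; the `v_i` are `M`-orthonormal and span the Krylov subspace
`𝒦_k(M^†AᵀGA, M^†AᵀGb)`; the `u_i` are `G`-orthonormal and span `𝒦_k(AM^†AᵀG, b)`. -/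
theorem stmt_10 (m n k : ℕ) (A : Matrix (Fin m) (Fin n) ℝ)
    (M : Matrix (Fin n) (Fin n) ℝ) (G : Matrix (Fin m) (Fin m) ℝ)
    (Mdag : Matrix (Fin n) (Fin n) ℝ) (b : Fin m → ℝ)
    (u : ℕ → Fin m → ℝ) (v : ℕ → Fin n → ℝ) (α β : ℕ → ℝ)
    (hM : M.PosSemidef) (hG : G.PosDef) (hb : b ≠ 0)
    -- Moore–Penrose pseudoinverse of `M`:
    (hMP1 : M * Mdag * M = M) (hMP2 : Mdag * M * Mdag = Mdag)
    (hMP3 : (M * Mdag)ᵀ = M * Mdag) (hMP4 : (Mdag * M)ᵀ = Mdag * M)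
    -- the gGKB recursions (with `v 0 = 0`):
    (hv0 : v 0 = 0)
    (hrecb : β 1 • u 1 = b)
    (hrecv : ∀ i, 1 ≤ i → α i • v i = (Mdag * Aᵀ * G).mulVec (u i) - β i • v (i - 1))
    (hrecu : ∀ i, 1 ≤ i → β (i + 1) • u (i + 1) = A.mulVec (v i) - α i • u i)
    -- normalization: `α_i, β_i ≥ 0`, `‖v_i‖_M = 1` and `‖u_i‖_G = 1` whenever nonzero:
    (hnonneg : ∀ i, 0 ≤ α i ∧ 0 ≤ β i)
    (hnormv : ∀ i, 1 ≤ i → α i ≠ 0 → v i ⬝ᵥ M.mulVec (v i) = 1)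
    (hnormu : ∀ i, 1 ≤ i → β i ≠ 0 → u i ⬝ᵥ G.mulVec (u i) = 1)
    -- no termination before step `k`:
    (hk : ∀ i, 1 ≤ i → i ≤ k → 0 < α i ∧ 0 < β i) :
    (∀ i, 1 ≤ i → i ≤ k → v i ∈ LinearMap.range M.mulVecLin) ∧
    (∀ i j, 1 ≤ i → i ≤ k → 1 ≤ j → j ≤ k →
      v i ⬝ᵥ M.mulVec (v j) = if i = j then 1 else 0) ∧
    Submodule.span ℝ (Set.range fun i : Fin k => v (i + 1))
      = Submodule.span ℝ (Set.range fun j : Fin k =>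
          ((Mdag * Aᵀ * G * A) ^ (j : ℕ)).mulVec ((Mdag * Aᵀ * G).mulVec b)) ∧
    (∀ i j, 1 ≤ i → i ≤ k → 1 ≤ j → j ≤ k →
      u i ⬝ᵥ G.mulVec (u j) = if i = j then 1 else 0) ∧
    Submodule.span ℝ (Set.range fun i : Fin k => u (i + 1))
      = Submodule.span ℝ (Set.range fun j : Fin k =>
          ((A * Mdag * Aᵀ * G) ^ (j : ℕ)).mulVec b) := by
  have hMt : Mᵀ = M := by simpa [conjTranspose_eq_transpose_of_trivial] using hM.isHermitian.eq
  set P := Mdag * Aᵀ * G with hP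
  have hPu : ∀ i, 1 ≤ i → P *ᵥ u i = α i • v i + β i • v (i - 1) := fun i hi => by
    rw [hrecv i hi, sub_add_cancel]
  have hAv : ∀ i, 1 ≤ i → A *ᵥ v i = β (i + 1) • u (i + 1) + α i • u i := fun i hi => by
    rw [hrecu i hi, sub_add_cancel]
  have hrange : ∀ i, i ≤ k → v i ∈ LinearMap.range M.mulVecLin := by
    intro i
    induction i with
    | zero => intro _; rw [hv0]; exact zero_mem _
    | succ i ih =>
      intro hi
      rw [← Submodule.smul_mem_iff _ (hk (i + 1) (by omega) hi).1.ne', hrecv (i + 1) (by omega)]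
      refine sub_mem ?_ (Submodule.smul_mem _ _ (ih (by omega)))
      rw [hP, Matrix.mul_assoc, ← mulVec_mulVec]
      exact pseudoinverse_mulVec_mem_range hMt hMP2 hMP4 _
  have hadj : ∀ i x, 1 ≤ i → i ≤ k →
      M.toBilin' (v i) (P.mulVecLin x) = G.toBilin' (A.mulVecLin (v i)) x := by
    intro i x _ hi
    obtain ⟨z, hz⟩ := hrange i hi
    have hproj : (M * Mdag) *ᵥ v i = v i := by
      rw [← hz, mulVecLin_apply, mulVec_mulVec, hMP1]
    simp only [toBilin'_apply', mulVecLin_apply, hP, Matrix.mul_assoc, mulVec_mulVec]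
    rw [← Matrix.mul_assoc, ← mulVec_mulVec, dotProduct_mulVec, ← mulVec_transpose, hMP3, hproj,
      ← mulVec_mulVec, dotProduct_mulVec, vecMul_transpose]
  have horth := golubKahan_orthonormal G.toBilin' M.toBilin' (toBilin'_apply_comm hG.isHermitian)
    (toBilin'_apply_comm hM.isHermitian) A.mulVecLin P.mulVecLin u v α β k hv0 hAv hPu hadj
    (fun i h1 h2 => (hk i h1 h2).1.ne') (fun i h1 h2 => (hk i h1 h2).2.ne')
    (fun i h1 h2 => by rw [toBilin'_apply']; exact hnormv i h1 (hk i h1 h2).1.ne')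
    (fun i h1 h2 => by rw [toBilin'_apply']; exact hnormu i h1 (hk i h1 h2).2.ne')
  simp only [toBilin'_apply'] at horth
  refine ⟨fun i _ hi => hrange i hi, horth.1, ?_, horth.2, ?_⟩
  · rw [range_fin_eq_image_Iio (fun i => v (i + 1)),
      range_fin_eq_image_Iio (fun j => ((P * A) ^ j) *ᵥ (P *ᵥ b))]
    refine span_image_Iio_eq_of_recurrence (P * A).mulVecLin _ _
      (fun j => β (j + 1) * α (j + 1)) k ?_ (fun j => ?_) (fun j hj => ?_) (fun j hj => ?_)
    · simp [← hrecb, mulVec_smul, hPu, hv0, smul_smul]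
    · simp [pow_succ', mulVec_mulVec, Matrix.mul_assoc]
    · exact mul_ne_zero (hk _ (by omega) (by omega)).2.ne' (hk _ (by omega) (by omega)).1.ne'
    · have h : ∀ i ≤ j + 1, v i ∈
          Submodule.span ℝ ((fun i => v (i + 1)) '' Set.Iio (j + 1)) := by
        rintro (_ | i) hi
        · rw [hv0]; exact zero_mem _
        · exact Submodule.subset_span ⟨i, by simpa using hi, rfl⟩
      have e : (P * A) *ᵥ v (j + 1) - (β (j + 2) * α (j + 2)) • v (j + 2) =
          (β (j + 2) * β (j + 2)) • v (j + 1) + (α (j + 1) * α (j + 1)) • v (j + 1) +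
            (α (j + 1) * β (j + 1)) • v j := by
        rw [← mulVec_mulVec, hAv (j + 1) (by omega), mulVec_add, mulVec_smul, mulVec_smul,
          hPu (j + 1) (by omega), hPu (j + 1 + 1) (by omega)]
        simp only [Nat.add_sub_cancel]
        module
      rw [mulVecLin_apply, e]
      exact add_mem (add_mem (Submodule.smul_mem _ _ (h _ le_rfl))
        (Submodule.smul_mem _ _ (h _ le_rfl))) (Submodule.smul_mem _ _ (h _ (by omega)))
  · have hAP : A * Mdag * Aᵀ * G = A * P := by simp only [hP, Matrix.mul_assoc]
    rw [hAP, range_fin_eq_image_Iio (fun i => u (i + 1)),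
      range_fin_eq_image_Iio (fun j => ((A * P) ^ j) *ᵥ b)]
    refine span_image_Iio_eq_of_recurrence (A * P).mulVecLin _ _
      (fun j => if j = 0 then β 1 else α j * β (j + 1)) k ?_ (fun j => ?_) (fun j hj => ?_)
      (fun j hj => ?_)
    · simp [hrecb]
    · simp [pow_succ', mulVec_mulVec, Matrix.mul_assoc]
    · split_ifs with h0
      · exact (hk 1 le_rfl (by omega)).2.ne'
      · exact mul_ne_zero (hk _ (by omega) (by omega)).1.ne' (hk _ (by omega) (by omega)).2.ne'
    · have h : ∀ i ≤ j, u (i + 1) ∈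
          Submodule.span ℝ ((fun i => u (i + 1)) '' Set.Iio (j + 1)) := fun i hi =>
        Submodule.subset_span ⟨i, Nat.lt_succ_of_le hi, rfl⟩
      have hAvj : A *ᵥ v j ∈ Submodule.span ℝ ((fun i => u (i + 1)) '' Set.Iio (j + 1)) := by
        rcases j with _ | j
        · rw [hv0, mulVec_zero]; exact zero_mem _
        · rw [hAv (j + 1) (by omega)]
          exact add_mem (Submodule.smul_mem _ _ (h _ le_rfl))
            (Submodule.smul_mem _ _ (h j (by omega)))
      have e : (A * P) *ᵥ u (j + 1) - (α (j + 1) * β (j + 2)) • u (j + 2) =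
          (α (j + 1) * α (j + 1)) • u (j + 1) + β (j + 1) • (A *ᵥ v j) := by
        rw [← mulVec_mulVec, hPu (j + 1) (by omega), mulVec_add, mulVec_smul, mulVec_smul,
          hAv (j + 1) (by omega)]
        simp only [Nat.add_sub_cancel]
        module
      rw [mulVecLin_apply, if_neg (by omega), e]
      exact add_mem (Submodule.smul_mem _ _ (h _ le_rfl)) (Submodule.smul_mem _ _ hAvj)
end

section
/- Let s := #{i ∈ {1,…,l} : G_iᵀ b ≠ 0}. Then the vectors C b, C² b, …, C^s b are linearly independent and span{C^j b : j ≥ 1} has dimension exactly s; moreover, if b ∈ range(G₁) ⊕ ⋯ ⊕ range(G_l), then span{C^j b : j ≥ 0} also has dimension s, i.e., the minimal k for which {b, Cb, …, C^k b} is linearly dependent equals s. -/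
open Matrix

section OrthogonalProjections

variable {ι m R : Type*} [Fintype m] [CommRing R]

/-- Powers of a combination of mutually orthogonal idempotents. -/
theorem sum_smul_pow_succ_of_orthogonal_idempotents [Fintype ι] {A : Type*} [Ring A] [Algebra R A]
    (P : ι → A) (c : ι → R) (hP : ∀ i, P i * P i = P i) (hPQ : ∀ i j, i ≠ j → P i * P j = 0)
    (n : ℕ) : (∑ i, c i • P i) ^ (n + 1) = ∑ i, c i ^ (n + 1) • P i := by
  classical
  induction n with
  | zero => simp
  | succ n ih =>
    rw [pow_succ, ih, Finset.sum_mul_sum]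
    refine Finset.sum_congr rfl fun i _ => ?_
    rw [Finset.sum_eq_single i]
    · rw [smul_mul_smul_comm, hP, ← pow_succ]
    · intro j _ hji
      rw [smul_mul_smul_comm, hPQ i j hji.symm, smul_zero]
    · simp

/-- A vector in the sum of the ranges of matrices with orthonormal columns and mutually orthogonal
ranges is the sum of its projections. -/
theorem sum_mul_transpose_mulVec_of_mem_iSup_range [Fintype ι] {d : ι → Type*}
    [∀ i, Fintype (d i)] [∀ i, DecidableEq (d i)] (G : ∀ i, Matrix m (d i) R)
    (horth : ∀ i, (G i)ᵀ * G i = 1) (horth' : ∀ i j, i ≠ j → (G i)ᵀ * G j = 0) {b : m → R}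
    (hb : b ∈ ⨆ i, LinearMap.range (G i).mulVecLin) :
    ∑ i, (G i * (G i)ᵀ) *ᵥ b = b := by
  classical
  induction hb using Submodule.iSup_induction' with
  | mem i x hx =>
    obtain ⟨y, rfl⟩ := hx
    rw [Finset.sum_eq_single i]
    · simp [Matrix.mulVec_mulVec, Matrix.mul_assoc, horth]
    · intro j _ hji
      simp [Matrix.mulVec_mulVec, Matrix.mul_assoc, horth' j i hji]
    · simp
  | zero => simp
  | add x y _ _ hx hy => simp only [Matrix.mulVec_add, Finset.sum_add_distrib, hx, hy]

/-- The nonzero components of a vector along mutually orthogonal ranges are linearly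
independent. -/
theorem linearIndependent_mul_transpose_mulVec {K κ : Type*} [Field K] {d : ι → Type*}
    [∀ i, Fintype (d i)] [∀ i, DecidableEq (d i)] (G : ∀ i, Matrix m (d i) K)
    (horth : ∀ i, (G i)ᵀ * G i = 1) (horth' : ∀ i j, i ≠ j → (G i)ᵀ * G j = 0) {b : m → K}
    [Fintype κ] {f : κ → ι} (hf : Function.Injective f) (hfb : ∀ k, (G (f k))ᵀ *ᵥ b ≠ 0) :
    LinearIndependent K fun k => (G (f k) * (G (f k))ᵀ) *ᵥ b := by
  classical
  rw [Fintype.linearIndependent_iff]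
  intro g hg k
  have h := congrArg ((G (f k))ᵀ.mulVecLin) hg
  rw [map_sum, Finset.sum_eq_single k, map_zero] at h
  · simpa [-Matrix.mulVecLin_transpose, Matrix.mulVec_smul, ← Matrix.mul_assoc, horth, hfb] using h
  · intro j _ hjk
    simp [-Matrix.mulVecLin_transpose, ← Matrix.mul_assoc,
      horth' _ _ fun h => hjk (hf h).symm]
  · simp

end OrthogonalProjections

/-- Vandermonde combinations of linearly independent vectors with distinct nonzero nodes are
linearly independent. -/
theorem LinearIndependent.sum_pow_succ_smul {K V : Type*} [Field K] [AddCommGroup V] [Module K V]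
    {n : ℕ} {v : Fin n → V} (hv : LinearIndependent K v) {c : Fin n → K}
    (hc : Function.Injective c) (hc0 : ∀ k, c k ≠ 0) :
    LinearIndependent K fun j : Fin n => ∑ k, c k ^ ((j : ℕ) + 1) • v k := by
  rw [Fintype.linearIndependent_iff] at hv ⊢
  intro g hg
  have key : ∀ k, ∑ j : Fin n, g j * c k ^ ((j : ℕ) + 1) = 0 := by
    refine hv _ ?_
    rw [← hg]
    simp only [Finset.sum_smul, Finset.smul_sum, smul_smul]
    exact Finset.sum_comm
  have h0 : g = 0 := by
    refine Matrix.eq_zero_of_forall_index_sum_pow_mul_eq_zero hc fun k => ?_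
    refine (mul_eq_zero.mp ?_).resolve_left (hc0 k)
    rw [← key k, Finset.mul_sum]
    exact Finset.sum_congr rfl fun j _ => by ring
  simp [h0]

/-- A set of vectors in the span of `n` vectors that contains `n` linearly independent ones spans
a space of dimension `n`. -/
theorem finrank_span_eq_of_subset_of_linearIndependent {K V : Type*} [Field K] [AddCommGroup V]
    [Module K V] [FiniteDimensional K V] {n : ℕ} {v w : Fin n → V} {s : Set V}
    (hw : LinearIndependent K w) (hws : Set.range w ⊆ s)
    (hs : s ⊆ Submodule.span K (Set.range v)) :
    Module.finrank K (Submodule.span K s) = n := by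
  apply le_antisymm
  · simpa using (Submodule.finrank_mono (Submodule.span_le.mpr hs)).trans
      (finrank_range_le_card (R := K) v)
  · simpa [finrank_span_eq_card hw] using Submodule.finrank_mono (Submodule.span_mono (R := K) hws)

/-- With `C = Σ λ_i G_i G_iᵀ` and `s := #{i : G_iᵀ b ≠ 0}`, the vectors
`C b, …, C^s b` are linearly independent and `span{C^j b : j ≥ 1}` has dimension exactly `s`;
moreover, if `b ∈ range(G₁) ⊕ ⋯ ⊕ range(G_l)` then `span{C^j b : j ≥ 0}` also has
dimension `s`. -/
theorem stmt_11 (m l : ℕ) (d : Fin l → ℕ) (lam : Fin l → ℝ)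
    (G : ∀ i : Fin l, Matrix (Fin m) (Fin (d i)) ℝ) (b : Fin m → ℝ)
    (hpos : ∀ i, 0 < lam i) (hinj : Function.Injective lam)
    (horth : ∀ i, (G i)ᵀ * G i = 1)
    (horth' : ∀ i j, i ≠ j → (G i)ᵀ * G j = 0) :
    LinearIndependent ℝ
      (fun j : Fin (Nat.card {i : Fin l // (G i)ᵀ.mulVec b ≠ 0}) =>
        ((∑ i, lam i • (G i * (G i)ᵀ)) ^ ((j : ℕ) + 1)).mulVec b) ∧
    Module.finrank ℝ (Submodule.span ℝ
        {w : Fin m → ℝ | ∃ j : ℕ, 1 ≤ j ∧ w = ((∑ i, lam i • (G i * (G i)ᵀ)) ^ j).mulVec b})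
      = Nat.card {i : Fin l // (G i)ᵀ.mulVec b ≠ 0} ∧
    (b ∈ ⨆ i, LinearMap.range (G i).mulVecLin →
      Module.finrank ℝ (Submodule.span ℝ
          {w : Fin m → ℝ | ∃ j : ℕ, w = ((∑ i, lam i • (G i * (G i)ᵀ)) ^ j).mulVec b})
        = Nat.card {i : Fin l // (G i)ᵀ.mulVec b ≠ 0}) := by
  classical
  set C := ∑ i, lam i • (G i * (G i)ᵀ) with hC
  set e := (Finite.equivFin {i : Fin l // (G i)ᵀ.mulVec b ≠ 0}).symm
  set v := fun k => (G (e k) * (G (e k))ᵀ) *ᵥ b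
  have he : Function.Injective fun k => (e k : Fin l) := Subtype.val_injective.comp e.injective
  have hv : LinearIndependent ℝ v :=
    linearIndependent_mul_transpose_mulVec G horth horth' he fun k => (e k).2
  have hsum (c : Fin l → ℝ) : ∑ i, c i • ((G i * (G i)ᵀ) *ᵥ b) = ∑ k, c (e k) • v k := by
    refine (Fintype.sum_of_injective _ he _ _ (fun i hi => ?_) fun _ => rfl).symm
    have hib : (G i)ᵀ *ᵥ b = 0 := by
      by_contra h
      exact hi ⟨e.symm ⟨i, h⟩, by simp⟩
    rw [← Matrix.mulVec_mulVec, hib, Matrix.mulVec_zero, smul_zero]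
  have hpow (n : ℕ) : (C ^ (n + 1)) *ᵥ b = ∑ k, lam (e k) ^ (n + 1) • v k := by
    rw [hC, sum_smul_pow_succ_of_orthogonal_idempotents, Matrix.sum_mulVec]
    · simpa only [Matrix.smul_mulVec] using hsum fun i => lam i ^ (n + 1)
    · intro i
      rw [Matrix.mul_assoc, ← Matrix.mul_assoc (G i)ᵀ, horth, Matrix.one_mul]
    · intro i j hij
      rw [Matrix.mul_assoc, ← Matrix.mul_assoc (G i)ᵀ, horth' i j hij, Matrix.zero_mul,
        Matrix.mul_zero]
  have hmem (c : Fin (Nat.card {i : Fin l // (G i)ᵀ.mulVec b ≠ 0}) → ℝ) :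
      ∑ k, c k • v k ∈ Submodule.span ℝ (Set.range v) :=
    Submodule.sum_mem _ fun k _ =>
      Submodule.smul_mem _ _ (Submodule.subset_span (Set.mem_range_self k))
  have hli : LinearIndependent ℝ fun j : Fin (Nat.card {i : Fin l // (G i)ᵀ.mulVec b ≠ 0}) =>
      (C ^ ((j : ℕ) + 1)) *ᵥ b := by
    simp only [hpow]
    exact hv.sum_pow_succ_smul (hinj.comp he) fun k => (hpos _).ne'
  refine ⟨hli, finrank_span_eq_of_subset_of_linearIndependent (v := v) hli ?_ ?_, fun hb =>
    finrank_span_eq_of_subset_of_linearIndependent (v := v) hli ?_ ?_⟩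
  · rintro _ ⟨j, rfl⟩
    exact ⟨j + 1, by omega, rfl⟩
  · rintro _ ⟨_ | n, hn, rfl⟩
    · omega
    · rw [hpow]
      exact hmem _
  · rintro _ ⟨j, rfl⟩
    exact ⟨j + 1, rfl⟩
  · rintro _ ⟨_ | n, rfl⟩
    · have h := hsum 1
      simp only [Pi.one_apply, one_smul,
        sum_mul_transpose_mulVec_of_mem_iSup_range G horth horth' hb] at h
      rw [pow_zero, Matrix.one_mulVec]
      simpa [← h] using hmem 1
    · rw [hpow]
      exact hmem _
end

section
/- Let s := #{i ∈ {1,…,l} : G_iᵀ b ≠ 0}. Then span{C^j b : 1 ≤ j ≤ s} = span{G_i G_iᵀ b : i with G_iᵀ b ≠ 0}; consequently, every vector w in span{C^j b : 1 ≤ j ≤ s} satisfies (Σ_{i=1}^l G_i G_iᵀ) w = w, i.e., this Krylov subspace is contained in the invariant subspace range(G₁) ⊕ ⋯ ⊕ range(G_l) of C. -/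
open Matrix

/-- A Vandermonde argument: the power sums `∑ i, x i ^ (j + 1) • v i` with distinct nonzero
nodes `x i` span the same subspace as the vectors `v i`. -/
theorem span_range_sum_pow_succ_smul {K M ι : Type*} [Field K] [AddCommGroup M] [Module K M]
    [Fintype ι] {x : ι → K} (hx : Function.Injective x) (hx0 : ∀ i, x i ≠ 0) (v : ι → M) :
    Submodule.span K (Set.range fun j : Fin (Nat.card ι) => ∑ i, x i ^ ((j : ℕ) + 1) • v i)
      = Submodule.span K (Set.range v) := by
  classical
  apply le_antisymm
  · rw [Submodule.span_le]
    rintro _ ⟨j, rfl⟩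
    exact Submodule.sum_mem _ fun i _ =>
      Submodule.smul_mem _ _ (Submodule.subset_span ⟨i, rfl⟩)
  · rw [Submodule.span_le]
    rintro _ ⟨k, rfl⟩
    set p := Lagrange.basis Finset.univ x k with hp
    have hcard : 0 < Nat.card ι := Nat.card_pos_iff.2 ⟨⟨k⟩, inferInstance⟩
    have hdeg : p.natDegree < Nat.card ι := by
      have h := Lagrange.degree_basis hx.injOn (Finset.mem_univ k)
      rw [Finset.card_univ, ← Nat.card_eq_fintype_card] at h
      have h' := Polynomial.natDegree_eq_of_degree_eq_some h
      rw [hp, h']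
      omega
    have hv : v k = ∑ j : Fin (Nat.card ι),
        ((x k)⁻¹ * p.coeff j) • ∑ i, x i ^ ((j : ℕ) + 1) • v i := by
      have heval (i : ι) : ∑ j : Fin (Nat.card ι), (x k)⁻¹ * p.coeff j * x i ^ ((j : ℕ) + 1)
          = (x k)⁻¹ * x i * p.eval (x i) := by
        rw [Polynomial.eval_eq_sum_range' hdeg, Finset.mul_sum, ← Fin.sum_univ_eq_sum_range
          (fun j => (x k)⁻¹ * x i * (p.coeff j * x i ^ j))]
        exact Finset.sum_congr rfl fun j _ => by ring
      simp_rw [Finset.smul_sum, smul_smul]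
      rw [Finset.sum_comm]
      simp_rw [← Finset.sum_smul, heval]
      rw [Finset.sum_eq_single k]
      · rw [hp, Lagrange.eval_basis_self hx.injOn (Finset.mem_univ k),
          inv_mul_cancel₀ (hx0 k), one_mul, one_smul]
      · intro i _ hik
        rw [hp, Lagrange.eval_basis_of_ne hik.symm (Finset.mem_univ i), mul_zero, zero_smul]
      · simp
    rw [hv]
    exact Submodule.sum_mem _ fun j _ =>
      Submodule.smul_mem _ _ (Submodule.subset_span ⟨j, rfl⟩)

/-- Positive powers of a combination of pairwise orthogonal idempotents. -/
theorem OrthogonalIdempotents.sum_smul_pow_succ {K A ι : Type*} [CommSemiring K] [Semiring A]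
    [Algebra K A] [Fintype ι] {P : ι → A} (hP : OrthogonalIdempotents P) (x : ι → K) (k : ℕ) :
    (∑ i, x i • P i) ^ (k + 1) = ∑ i, x i ^ (k + 1) • P i := by
  classical
  induction k with
  | zero => simp
  | succ k ih =>
    rw [pow_succ, ih, Finset.sum_mul_sum]
    simp [hP.mul_eq, pow_succ, smul_smul, mul_comm]

/-- With `C = Σ λ_i G_i G_iᵀ` and `s := #{i : G_iᵀ b ≠ 0}`,
`span{C^j b : 1 ≤ j ≤ s} = span{G_i G_iᵀ b : G_iᵀ b ≠ 0}`; consequently every `w` in this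
span satisfies `(Σ G_i G_iᵀ) w = w`, i.e. the Krylov subspace is contained in the invariant
subspace `range(G₁) ⊕ ⋯ ⊕ range(G_l)` of `C`. -/
theorem stmt_18 (m l : ℕ) (d : Fin l → ℕ) (lam : Fin l → ℝ)
    (G : ∀ i : Fin l, Matrix (Fin m) (Fin (d i)) ℝ) (b : Fin m → ℝ)
    (hpos : ∀ i, 0 < lam i) (hinj : Function.Injective lam)
    (horth : ∀ i, (G i)ᵀ * G i = 1)
    (horth' : ∀ i j, i ≠ j → (G i)ᵀ * G j = 0) :
    Submodule.span ℝ (Set.range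
        fun j : Fin (Nat.card {i : Fin l // (G i)ᵀ.mulVec b ≠ 0}) =>
          ((∑ i, lam i • (G i * (G i)ᵀ)) ^ ((j : ℕ) + 1)).mulVec b)
      = Submodule.span ℝ
          {w : Fin m → ℝ | ∃ i : Fin l, (G i)ᵀ.mulVec b ≠ 0 ∧
            w = (G i * (G i)ᵀ).mulVec b} ∧
    (∀ w ∈ Submodule.span ℝ (Set.range
        fun j : Fin (Nat.card {i : Fin l // (G i)ᵀ.mulVec b ≠ 0}) =>
          ((∑ i, lam i • (G i * (G i)ᵀ)) ^ ((j : ℕ) + 1)).mulVec b),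
      (∑ i, G i * (G i)ᵀ).mulVec w = w) ∧
    Submodule.span ℝ (Set.range
        fun j : Fin (Nat.card {i : Fin l // (G i)ᵀ.mulVec b ≠ 0}) =>
          ((∑ i, lam i • (G i * (G i)ᵀ)) ^ ((j : ℕ) + 1)).mulVec b)
      ≤ ⨆ i, LinearMap.range (G i).mulVecLin := by
  have hP : OrthogonalIdempotents fun i => G i * (G i)ᵀ := by
    refine ⟨fun i => ?_, fun i j hij => ?_⟩
    · change G i * (G i)ᵀ * (G i * (G i)ᵀ) = G i * (G i)ᵀ
      rw [Matrix.mul_assoc, ← Matrix.mul_assoc (G i)ᵀ, horth, Matrix.one_mul]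
    · change G i * (G i)ᵀ * (G j * (G j)ᵀ) = 0
      rw [Matrix.mul_assoc, ← Matrix.mul_assoc (G i)ᵀ, horth' i j hij, Matrix.zero_mul,
        Matrix.mul_zero]
  have hspan : Submodule.span ℝ (Set.range
        fun j : Fin (Nat.card {i : Fin l // (G i)ᵀ.mulVec b ≠ 0}) =>
          ((∑ i, lam i • (G i * (G i)ᵀ)) ^ ((j : ℕ) + 1)).mulVec b)
      = Submodule.span ℝ
          {w : Fin m → ℝ | ∃ i : Fin l, (G i)ᵀ.mulVec b ≠ 0 ∧
            w = (G i * (G i)ᵀ).mulVec b} := by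
    classical
    have hset : {w : Fin m → ℝ | ∃ i : Fin l, (G i)ᵀ.mulVec b ≠ 0 ∧
          w = (G i * (G i)ᵀ).mulVec b}
        = Set.range fun i : {i : Fin l // (G i)ᵀ.mulVec b ≠ 0} =>
          (G i * (G i)ᵀ).mulVec b := by
      ext w
      exact ⟨fun ⟨i, hi, hw⟩ => ⟨⟨i, hi⟩, hw.symm⟩, fun ⟨i, hw⟩ => ⟨i, i.2, hw.symm⟩⟩
    rw [hset, ← span_range_sum_pow_succ_smul (x := fun i : {i : Fin l // (G i)ᵀ.mulVec b ≠ 0} =>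
      lam i) (hinj.comp Subtype.val_injective) fun i => (hpos i).ne']
    congr 2
    funext j
    rw [hP.sum_smul_pow_succ, Matrix.sum_mulVec]
    simp_rw [Matrix.smul_mulVec]
    rw [← Fintype.sum_subtype_add_sum_subtype (fun i : Fin l => (G i)ᵀ.mulVec b ≠ 0),
      Finset.sum_eq_zero (s := (Finset.univ : Finset {i : Fin l // ¬ (G i)ᵀ.mulVec b ≠ 0})),
      add_zero]
    rintro ⟨i, hi⟩ -
    rw [← Matrix.mulVec_mulVec, not_ne_iff.1 hi, Matrix.mulVec_zero, smul_zero]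
  refine ⟨hspan, ?_, ?_⟩
  · rw [hspan]
    intro w hw
    induction hw using Submodule.span_induction with
    | mem w hw =>
      obtain ⟨i, -, rfl⟩ := hw
      rw [Matrix.mulVec_mulVec, Finset.sum_mul, Finset.sum_eq_single i]
      · rw [(hP.idem i).eq]
      · exact fun j _ hj => by rw [hP.ortho hj]
      · simp
    | zero => exact Matrix.mulVec_zero _
    | add u v _ _ hu hv => rw [Matrix.mulVec_add, hu, hv]
    | smul a u _ hu => rw [Matrix.mulVec_smul, hu]
  · rw [hspan, Submodule.span_le]
    rintro _ ⟨i, -, rfl⟩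
    exact Submodule.mem_iSup_of_mem i ⟨(G i)ᵀ.mulVec b, by simp [Matrix.mulVec_mulVec]⟩
end
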